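/- Theorem 4.2, second estimate (uniform-in-time L₂ error of dG(0) and dG(1) for the displacement). Let q ∈ {0,1}. There is a constant C > 0, independent of T = t_N, N and the mesh, such that the error e₁ := U₁ − u₁ satisfies ‖e₁‖_{I_N} ≤ C ( k^{q+1} ‖u₁^{(q+1)}‖_{I_N} + Σ_{n=1}^N k_n^{q+2} ‖u₂^{(q+1)}‖_{I_n} + Σ_{n=1}^N k_n^{q+2} ‖u₁^{(q+1)}‖_{1,I_n} ), provided the right-hand side is finite. -/

import Mathlib

noncomputable section

open scoped RealInnerProductSpace BigOperators
open MeasureTheory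

/-- Squared fractional-order norm `‖v‖_α² = Σ_k λ_k^α (v,φ_k)²`. -/
def hsNormSq {H : Type*} [NormedAddCommGroup H] [InnerProductSpace ℝ H]
    (φ : ℕ → H) (lam : ℕ → ℝ) (α : ℝ) (v : H) : ℝ :=
  ∑' k, lam k ^ α * ⟪v, φ k⟫ ^ 2

/-- Fractional-order norm `‖v‖_α`. -/
def hsNorm {H : Type*} [NormedAddCommGroup H] [InnerProductSpace ℝ H]
    (φ : ℕ → H) (lam : ℕ → ℝ) (α : ℝ) (v : H) : ℝ :=
  Real.sqrt (hsNormSq φ lam α v)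

/-- Membership in the fractional-order space `Ḣ^α`. -/
def MemHs {H : Type*} [NormedAddCommGroup H] [InnerProductSpace ℝ H]
    (φ : ℕ → H) (lam : ℕ → ℝ) (α : ℝ) (v : H) : Prop :=
  Summable (fun k => lam k ^ α * ⟪v, φ k⟫ ^ 2)

/-- Weighted spectral pairing `Σ_k λ_k^l (u,φ_k)(v,φ_k)`.
`aPow φ lam 1 u v = a(u,v)`, `aPow φ lam (l+1) u v = a(u, A^l v)` and
`aPow φ lam l u v = (u, A^l v)`. -/
def aPow {H : Type*} [NormedAddCommGroup H] [InnerProductSpace ℝ H]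
    (φ : ℕ → H) (lam : ℕ → ℝ) (l : ℝ) (u v : H) : ℝ :=
  ∑' k, lam k ^ l * ⟪u, φ k⟫ * ⟪v, φ k⟫

/-- The energy bilinear form `a(u,v) = Σ_k λ_k (u,φ_k)(v,φ_k)`. -/
def aForm {H : Type*} [NormedAddCommGroup H] [InnerProductSpace ℝ H]
    (φ : ℕ → H) (lam : ℕ → ℝ) (u v : H) : ℝ :=
  aPow φ lam 1 u v

/-- The operator `A`, determined by `A φ_k = λ_k φ_k`. -/
def Aop {H : Type*} [NormedAddCommGroup H] [InnerProductSpace ℝ H]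
    (φ : ℕ → H) (lam : ℕ → ℝ) (v : H) : H :=
  ∑' k, (lam k * ⟪v, φ k⟫) • φ k

/-- Value at time `s` of the polynomial of degree ≤ q (with coefficients `c n ·`)
attached to the `n`-th time subinterval. -/
def pval {H : Type*} [NormedAddCommGroup H] [InnerProductSpace ℝ H]
    (q : ℕ) (c : ℕ → ℕ → H) (n : ℕ) (s : ℝ) : H :=
  ∑ j ∈ Finset.range (q + 1), s ^ j • c n j

/-- Time derivative of `pval`. -/
def pderiv {H : Type*} [NormedAddCommGroup H] [InnerProductSpace ℝ H]
    (q : ℕ) (c : ℕ → ℕ → H) (n : ℕ) (s : ℝ) : H :=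
  ∑ j ∈ Finset.range (q + 1), ((j : ℝ) * s ^ (j - 1)) • c n j

/-- The dG bilinear form `B((u₁,u₂),(v₁,v₂))`, where the piecewise polynomials
`u₁, u₂, v₁, v₂` are described by their coefficient families `c1, c2, d1, d2`
(on the mesh `0 = tt 0 < tt 1 < ⋯ < tt N`). -/
def Bform {H : Type*} [NormedAddCommGroup H] [InnerProductSpace ℝ H]
    (φ : ℕ → H) (lam : ℕ → ℝ) (tt : ℕ → ℝ) (N q : ℕ)
    (c1 c2 d1 d2 : ℕ → ℕ → H) : ℝ :=
  (∑ n ∈ Finset.Icc 1 N, ∫ s in tt (n-1)..tt n,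
      (aForm φ lam (pderiv q c1 n s) (pval q d1 n s)
        - aForm φ lam (pval q c2 n s) (pval q d1 n s)
        + ⟪pderiv q c2 n s, pval q d2 n s⟫
        + aForm φ lam (pval q c1 n s) (pval q d2 n s)))
  + (∑ n ∈ Finset.Icc 1 (N-1),
      (aForm φ lam (pval q c1 (n+1) (tt n) - pval q c1 n (tt n)) (pval q d1 (n+1) (tt n))
        + ⟪pval q c2 (n+1) (tt n) - pval q c2 n (tt n), pval q d2 (n+1) (tt n)⟫))
  + aForm φ lam (pval q c1 1 (tt 0)) (pval q d1 1 (tt 0))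
  + ⟪pval q c2 1 (tt 0), pval q d2 1 (tt 0)⟫

/-- Supremum of `g` over the open interval `(a,b)`. -/
def supIoo (g : ℝ → ℝ) (a b : ℝ) : ℝ :=
  sSup (g '' Set.Ioo a b)

/-- Squared discrete fractional norm `‖v‖_{h,s}² = ‖A_h^{s/2} v‖²`, expressed through
an orthonormal eigenbasis `e` of `A_h` on `S_h` with eigenvalues `μ`. -/
def hNormSqh {H : Type*} [NormedAddCommGroup H] [InnerProductSpace ℝ H]
    {m : ℕ} (e : Fin m → H) (μ : Fin m → ℝ) (s : ℝ) (v : H) : ℝ :=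
  ∑ i, μ i ^ s * ⟪v, e i⟫ ^ 2

/-- Discrete fractional norm `‖v‖_{h,s}`. -/
def hNormh {H : Type*} [NormedAddCommGroup H] [InnerProductSpace ℝ H]
    {m : ℕ} (e : Fin m → H) (μ : Fin m → ℝ) (s : ℝ) (v : H) : ℝ :=
  Real.sqrt (hNormSqh e μ s v)

/-- Discrete weighted pairing: `aPowh e μ (l+1) u v = a(u, A_h^l v)` and
`aPowh e μ l u v = (u, A_h^l v)` for `u, v ∈ S_h`. -/
def aPowh {H : Type*} [NormedAddCommGroup H] [InnerProductSpace ℝ H]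
    {m : ℕ} (e : Fin m → H) (μ : Fin m → ℝ) (l : ℝ) (u v : H) : ℝ :=
  ∑ i, μ i ^ l * ⟪u, e i⟫ * ⟪v, e i⟫


/-- Slope of the dG projection of `w` on `(a, b)`: zero for `q = 0`; otherwise the slope for which
the affine interpolant through `(b, w b)` has the same mean as `w`. -/
def dgSlope {E : Type*} [NormedAddCommGroup E] [NormedSpace ℝ E]
    (q : ℕ) (a b : ℝ) (w : ℝ → E) : E :=
  if q = 0 then 0 else (2 / (b - a) ^ 2) • ((b - a) • w b - ∫ s in a..b, w s)

/-- The dG projection of `w` on `(a, b)`, of degree at most `q ∈ {0, 1}`. -/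
def dgProj {E : Type*} [NormedAddCommGroup E] [NormedSpace ℝ E]
    (q : ℕ) (a b : ℝ) (w : ℝ → E) (t : ℝ) : E :=
  w b + (t - b) • dgSlope q a b w

lemma dgProj_right {E : Type*} [NormedAddCommGroup E] [NormedSpace ℝ E]
    (q : ℕ) (a b : ℝ) (w : ℝ → E) : dgProj q a b w b = w b := by
  simp [dgProj]

lemma continuous_dgProj {E : Type*} [NormedAddCommGroup E] [NormedSpace ℝ E]
    (q : ℕ) (a b : ℝ) (w : ℝ → E) : Continuous (dgProj q a b w) := by
  unfold dgProj
  fun_prop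

lemma integral_dgProj_sub {E : Type*} [NormedAddCommGroup E] [NormedSpace ℝ E] [CompleteSpace E]
    {q : ℕ} (hq : q ≠ 0) {a b : ℝ} (hab : a < b) {w : ℝ → E} (hw : ContinuousOn w (Set.Icc a b)) :
    ∫ s in a..b, (dgProj q a b w s - w s) = 0 := by
  have hwi : IntervalIntegrable w volume a b :=
    ContinuousOn.intervalIntegrable (by rwa [Set.uIcc_of_le hab.le])
  rw [intervalIntegral.integral_sub ((continuous_dgProj q a b w).intervalIntegrable _ _) hwi]
  unfold dgProj
  rw [intervalIntegral.integral_add (by simp)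
    (Continuous.intervalIntegrable (by fun_prop) _ _), intervalIntegral.integral_smul_const]
  have h0 : ∫ s in a..b, (s - b) = -(b - a) ^ 2 / 2 := by
    rw [intervalIntegral.integral_sub (by simp) (by simp)]
    simp
    ring
  have h1 : b - a ≠ 0 := by linarith
  rw [h0, dgSlope, if_neg hq, smul_smul]
  have h2 : -(b - a) ^ 2 / 2 * (2 / (b - a) ^ 2) = -1 := by field_simp
  rw [h2]
  simp

lemma ContinuousLinearMap.map_dgProj {E F : Type*} [NormedAddCommGroup E] [NormedSpace ℝ E]
    [CompleteSpace E] [NormedAddCommGroup F] [NormedSpace ℝ F] [CompleteSpace F]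
    (L : E →L[ℝ] F) (q : ℕ) {a b : ℝ} (hab : a ≤ b) {w : ℝ → E}
    (hw : ContinuousOn w (Set.Icc a b)) (t : ℝ) :
    L (dgProj q a b w t) = dgProj q a b (fun s => L (w s)) t := by
  have hwi : IntervalIntegrable w volume a b :=
    ContinuousOn.intervalIntegrable (by rwa [Set.uIcc_of_le hab])
  unfold dgProj dgSlope
  rw [L.intervalIntegral_comp_comm hwi]
  split_ifs <;> simp

/-- Mean value inequality with the derivative controlled on the open interval only. -/
lemma norm_sub_le_of_hasDerivAt_Ioo {E : Type*} [NormedAddCommGroup E] [NormedSpace ℝ E]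
    {a b M : ℝ} (hab : a < b) {w w' : ℝ → E} (hw : ContinuousOn w (Set.Icc a b))
    (hd : ∀ t ∈ Set.Ioo a b, HasDerivAt w (w' t) t) (hM : ∀ t ∈ Set.Ioo a b, ‖w' t‖ ≤ M)
    {x y : ℝ} (hx : x ∈ Set.Icc a b) (hy : y ∈ Set.Icc a b) : ‖w y - w x‖ ≤ M * (b - a) := by
  have hmid : (a + b) / 2 ∈ Set.Ioo a b := ⟨by linarith, by linarith⟩
  have hM0 : 0 ≤ M := (norm_nonneg _).trans (hM _ hmid)
  have hcl : closure (Set.Ioo a b) = Set.Icc a b := closure_Ioo hab.ne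
  have h1 : ∀ x ∈ Set.Ioo a b, ∀ y ∈ Set.Ioo a b, ‖w y - w x‖ ≤ M * (b - a) := by
    intro x hx y hy
    refine ((convex_Ioo a b).norm_image_sub_le_of_norm_hasDerivWithin_le
      (fun t ht => (hd t ht).hasDerivWithinAt) hM hx hy).trans ?_
    refine mul_le_mul_of_nonneg_left ?_ hM0
    rw [Real.norm_eq_abs, abs_le]
    constructor <;> linarith [hx.1, hx.2, hy.1, hy.2]
  have h2 : ∀ x ∈ Set.Ioo a b, ∀ y ∈ Set.Icc a b, ‖w y - w x‖ ≤ M * (b - a) := by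
    intro x hx y hy
    exact le_on_closure (f := fun y => ‖w y - w x‖) (g := fun _ => M * (b - a)) (h1 x hx)
      (by rw [hcl]; fun_prop) continuousOn_const (by rwa [hcl])
  exact le_on_closure (f := fun x => ‖w y - w x‖) (g := fun _ => M * (b - a))
    (fun x hx => h2 x hx y hy) (by rw [hcl]; fun_prop) continuousOn_const (by rwa [hcl])

lemma norm_dgProj_zero_sub_le {E : Type*} [NormedAddCommGroup E] [NormedSpace ℝ E]
    {a b M : ℝ} (hab : a < b) {w w' : ℝ → E} (hw : ContinuousOn w (Set.Icc a b))
    (hd : ∀ t ∈ Set.Ioo a b, HasDerivAt w (w' t) t) (hM : ∀ t ∈ Set.Ioo a b, ‖w' t‖ ≤ M)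
    {t : ℝ} (ht : t ∈ Set.Icc a b) : ‖dgProj 0 a b w t - w t‖ ≤ (b - a) * M := by
  have := norm_sub_le_of_hasDerivAt_Ioo hab hw hd hM ht (Set.right_mem_Icc.2 hab.le)
  simpa [dgProj, dgSlope, mul_comm] using this

lemma norm_dgProj_one_sub_le {E : Type*} [NormedAddCommGroup E] [NormedSpace ℝ E] [CompleteSpace E]
    {a b M : ℝ} (hab : a < b) {w w' w'' : ℝ → E} (hw : ContinuousOn w (Set.Icc a b))
    (hd : ∀ t ∈ Set.Ioo a b, HasDerivAt w (w' t) t)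
    (hd' : ∀ t ∈ Set.Ioo a b, HasDerivAt w' (w'' t) t) (hM : ∀ t ∈ Set.Ioo a b, ‖w'' t‖ ≤ M)
    {t : ℝ} (ht : t ∈ Set.Icc a b) : ‖dgProj 1 a b w t - w t‖ ≤ 6 * ((b - a) ^ 2 * M) := by
  have hh : 0 < b - a := by linarith
  have hwi : IntervalIntegrable w volume a b :=
    ContinuousOn.intervalIntegrable (by rwa [Set.uIcc_of_le hab.le])
  set m := (a + b) / 2 with hm
  have hmid : m ∈ Set.Ioo a b := ⟨by linarith, by linarith⟩
  have hM0 : 0 ≤ M := (norm_nonneg _).trans (hM _ hmid)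
  set r : ℝ → E := fun s => w s - w m - (s - m) • w' m with hr
  have hrd : ∀ s ∈ Set.Ioo a b, HasDerivAt r (w' s - w' m) s := by
    intro s hs
    have h1 : HasDerivAt (fun s : ℝ => (s - m) • w' m) ((1 : ℝ) • w' m) s :=
      ((hasDerivAt_id s).sub_const m).smul_const (w' m)
    rw [one_smul] at h1
    exact ((hd s hs).sub_const (w m)).sub h1
  have hrb : ∀ s ∈ Set.Icc a b, ‖r s‖ ≤ M * (b - a) * (b - a) := by
    intro s hs
    have := norm_sub_le_of_hasDerivAt_Ioo hab (w := r) (w' := fun s => w' s - w' m)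
      (M := M * (b - a)) (by fun_prop) hrd (fun s hs => ?_) (Set.Ioo_subset_Icc_self hmid) hs
    · simpa [hr] using this
    · refine ((convex_Ioo a b).norm_image_sub_le_of_norm_hasDerivWithin_le
        (fun t ht => (hd' t ht).hasDerivWithinAt) hM hmid hs).trans ?_
      refine mul_le_mul_of_nonneg_left ?_ hM0
      rw [Real.norm_eq_abs, abs_le]
      constructor <;> linarith [hs.1, hs.2, hmid.1, hmid.2]
  have hIntegral : ∫ s in a..b, r s = (∫ s in a..b, w s) - (b - a) • w m := by
    have h0 : ∫ s in a..b, (s - m) = 0 := by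
      rw [intervalIntegral.integral_sub (by simp) (by simp)]
      simp [hm]
      ring
    rw [hr, intervalIntegral.integral_sub (hwi.sub (by simp))
      (Continuous.intervalIntegrable (by fun_prop) _ _),
      intervalIntegral.integral_sub hwi (by simp), intervalIntegral.integral_smul_const, h0]
    simp
  have hib : ‖∫ s in a..b, r s‖ ≤ M * (b - a) * (b - a) * (b - a) := by
    have := intervalIntegral.norm_integral_le_of_norm_le_const (f := r) (a := a) (b := b)
      (C := M * (b - a) * (b - a)) (fun s hs => hrb s ?_)
    · rwa [abs_of_pos hh] at this
    · rw [Set.uIoc_of_le hab.le] at hs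
      exact Set.Ioc_subset_Icc_self hs
  have hslope : dgSlope 1 a b w
      = w' m + (2 / (b - a) ^ 2) • ((b - a) • r b - ∫ s in a..b, r s) := by
    have h1 : (2 / (b - a) ^ 2) • ((b - a) • ((b - m) • w' m)) = w' m := by
      rw [smul_smul, smul_smul]
      have : 2 / (b - a) ^ 2 * (b - a) * (b - m) = 1 := by
        rw [hm]; field_simp; ring
      rw [this, one_smul]
    have h2 : w' m + (2 / (b - a) ^ 2) • ((b - a) • r b - ∫ s in a..b, r s)
        = (2 / (b - a) ^ 2) • ((b - a) • ((b - m) • w' m))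
          + (2 / (b - a) ^ 2) • ((b - a) • r b - ∫ s in a..b, r s) := by rw [h1]
    rw [h2, hIntegral, dgSlope, if_neg one_ne_zero, ← smul_add]
    congr 1
    simp only [hr, smul_sub]
    abel
  have hkey : dgProj 1 a b w t - w t
      = r b - r t + ((t - b) * (2 / (b - a) ^ 2)) • ((b - a) • r b - ∫ s in a..b, r s) := by
    rw [dgProj, hslope]
    simp only [hr]
    module
  have hb := hrb b (Set.right_mem_Icc.2 hab.le)
  have hsc : ‖(t - b) * (2 / (b - a) ^ 2)‖ ≤ 2 / (b - a) := by
    rw [norm_mul, Real.norm_eq_abs, Real.norm_eq_abs, abs_of_nonneg (a := 2 / (b - a) ^ 2)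
      (by positivity)]
    have : |t - b| ≤ b - a := by rw [abs_le]; constructor <;> linarith [ht.1, ht.2]
    calc |t - b| * (2 / (b - a) ^ 2) ≤ (b - a) * (2 / (b - a) ^ 2) := by gcongr
      _ = 2 / (b - a) := by field_simp
  have h3 : ‖(b - a) • r b - ∫ s in a..b, r s‖ ≤ 2 * (M * (b - a) * (b - a) * (b - a)) := by
    refine (norm_sub_le _ _).trans ?_
    rw [norm_smul, Real.norm_of_nonneg hh.le]
    have := mul_le_mul_of_nonneg_left hb hh.le
    linarith
  rw [hkey]
  refine (norm_add_le _ _).trans ?_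
  rw [norm_smul]
  have h4 := (norm_sub_le (r b) (r t)).trans (add_le_add hb (hrb t ht))
  have h5 := mul_le_mul hsc h3 (norm_nonneg _) (by positivity)
  have h6 : 2 / (b - a) * (2 * (M * (b - a) * (b - a) * (b - a)))
      = 4 * (M * (b - a) * (b - a)) := by field_simp; ring
  rw [h6] at h5
  linarith

/-- Approximation estimate for the dG projection, seen through a continuous linear map. -/
lemma norm_map_dgProj_sub_le {E F : Type*} [NormedAddCommGroup E] [NormedSpace ℝ E]
    [CompleteSpace E] [NormedAddCommGroup F] [NormedSpace ℝ F] [CompleteSpace F]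
    (L : E →L[ℝ] F) {q : ℕ} (hq : q = 0 ∨ q = 1) {a b M : ℝ} (hab : a < b) {w : ℝ → E}
    (hw : ContinuousOn w (Set.Icc a b))
    (hd : ∀ m < q + 1, ∀ t ∈ Set.Ioo a b,
      HasDerivAt (iteratedDeriv m w) (iteratedDeriv (m + 1) w t) t)
    (hM : ∀ t ∈ Set.Ioo a b, ‖L (iteratedDeriv (q + 1) w t)‖ ≤ M) {t : ℝ}
    (ht : t ∈ Set.Icc a b) :
    ‖L (dgProj q a b w t - w t)‖ ≤ 6 * ((b - a) ^ (q + 1) * M) := by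
  have hmid : (a + b) / 2 ∈ Set.Ioo a b := ⟨by linarith, by linarith⟩
  have hM0 : 0 ≤ M := (norm_nonneg _).trans (hM _ hmid)
  have hLw : ContinuousOn (fun s => L (w s)) (Set.Icc a b) := L.continuous.comp_continuousOn hw
  have hLd : ∀ m < q + 1, ∀ t ∈ Set.Ioo a b,
      HasDerivAt (fun s => L (iteratedDeriv m w s)) (L (iteratedDeriv (m + 1) w t)) t :=
    fun m hm t ht => L.hasFDerivAt.comp_hasDerivAt t (hd m hm t ht)
  rw [map_sub, L.map_dgProj q hab.le hw]
  rcases hq with rfl | rfl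
  · have h := norm_dgProj_zero_sub_le hab hLw (w' := fun t => L (iteratedDeriv 1 w t))
      (by simpa using hLd 0 (by norm_num)) hM ht
    have : 0 ≤ (b - a) * M := mul_nonneg (by linarith) hM0
    simp only [zero_add, pow_one]
    linarith
  · exact norm_dgProj_one_sub_le hab hLw (w' := fun t => L (iteratedDeriv 1 w t))
      (by simpa using hLd 0 (by norm_num)) (hLd 1 (by norm_num)) hM ht

lemma integral_affine_consistency {a b : ℝ} (hab : a < b) {u u' : ℝ → ℝ}
    (hu : ContinuousOn u (Set.Icc a b)) (hd : ∀ t ∈ Set.Ioo a b, HasDerivAt u (u' t) t)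
    (hi : IntervalIntegrable u' volume a b) {s x y : ℝ}
    (hy : y = 0 ∨ ∫ t in a..b, (u b + (t - b) * s - u t) = 0) :
    (∫ t in a..b, s * (x + t * y)) + (u b + (a - b) * s - u a) * (x + a * y)
      = ∫ t in a..b, u' t * (x + t * y) := by
  have hu' : ContinuousOn u (Set.uIcc a b) := by rwa [Set.uIcc_of_le hab.le]
  have hv : ∀ t, HasDerivAt (fun t : ℝ => x + t * y) y t := fun t => by
    simpa using ((hasDerivAt_id t).mul_const y).const_add x
  have hη : ∀ t ∈ Set.Ioo a b, HasDerivAt (fun t => u b + (t - b) * s - u t) (s - u' t) t := by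
    intro t ht
    have h1 : HasDerivAt (fun t : ℝ => u b + (t - b) * s) s t := by
      simpa using (((hasDerivAt_id t).sub_const b).mul_const s).const_add (u b)
    exact h1.sub (hd t ht)
  have hηi : IntervalIntegrable (fun t => u b + (t - b) * s - u t) volume a b :=
    ContinuousOn.intervalIntegrable (by fun_prop)
  have hi' : IntervalIntegrable (fun t => u' t * (x + t * y)) volume a b :=
    hi.mul_continuousOn (by fun_prop)
  have hsi : IntervalIntegrable (fun t => s * (x + t * y)) volume a b :=
    Continuous.intervalIntegrable (by fun_prop) _ _
  have key := intervalIntegral.integral_deriv_mul_eq_sub_of_hasDerivAt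
    (a := a) (b := b) (u := fun t => u b + (t - b) * s - u t) (v := fun t => x + t * y)
    (u' := fun t => s - u' t) (v' := fun _ => y) (by fun_prop) (by fun_prop)
    (by rwa [min_eq_left hab.le, max_eq_right hab.le]) (fun t _ => hv t)
    (IntervalIntegrable.sub (by simp) hi) (by simp)
  have hsplit : ∫ t in a..b, ((s - u' t) * (x + t * y) + (u b + (t - b) * s - u t) * y)
      = (∫ t in a..b, s * (x + t * y)) - (∫ t in a..b, u' t * (x + t * y))
        + (∫ t in a..b, (u b + (t - b) * s - u t)) * y := by
    rw [← intervalIntegral.integral_mul_const, ← intervalIntegral.integral_sub hsi hi',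
      ← intervalIntegral.integral_add (hsi.sub hi') (hηi.mul_const y)]
    congr 1
    funext t
    ring
  have hz : (∫ t in a..b, (u b + (t - b) * s - u t)) * y = 0 := by
    rcases hy with h | h <;> simp [h]
  rw [hsplit, hz] at key
  simp only [sub_self, zero_mul, add_zero, zero_sub] at key
  linarith

lemma integral_slope_mul_affine (a b x y : ℝ) :
    ∫ t in a..b, y * (x + t * y) = ((x + b * y) ^ 2 - (x + a * y) ^ 2) / 2 := by
  have h : ∀ t ∈ Set.uIcc a b,
      HasDerivAt (fun t : ℝ => (x + t * y) ^ 2 / 2) (y * (x + t * y)) t := fun t _ => by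
    have h1 : HasDerivAt (fun t : ℝ => x + t * y) y t := by
      simpa using ((hasDerivAt_id t).mul_const y).const_add x
    refine ((h1.pow 2).div_const 2).congr_deriv ?_
    push_cast
    ring
  rw [intervalIntegral.integral_eq_sub_of_hasDerivAt h
    (Continuous.intervalIntegrable (by fun_prop) _ _)]
  ring

/-- Energy identity on one subinterval for one spectral mode with eigenvalue `l`.  The discrete
solution is `A i + t * B i`, the projection of `u i` is `u i b + (t - b) * s i`, `p i` is the
incoming nodal value, and `c` says that all slopes vanish. -/
lemma mode_energy_identity {a b l : ℝ} (hab : a < b) (hl : 0 < l) (c : Prop)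
    {A1 B1 A2 B2 s1 s2 p1 p2 : ℝ} {u1 u2 f : ℝ → ℝ}
    (hu1 : ContinuousOn u1 (Set.Icc a b)) (hu2 : ContinuousOn u2 (Set.Icc a b))
    (hd1 : ∀ t ∈ Set.Ioo a b, HasDerivAt u1 (u2 t) t)
    (hd2 : ∀ t ∈ Set.Ioo a b, HasDerivAt u2 (f t - l * u1 t) t)
    (hf : IntervalIntegrable f volume a b)
    (hc : c → (B1 = 0 ∧ B2 = 0) ∧ s1 = 0 ∧ s2 = 0)
    (hnc : ¬ c → (∫ t in a..b, (u1 b + (t - b) * s1 - u1 t) = 0) ∧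
      ∫ t in a..b, (u2 b + (t - b) * s2 - u2 t) = 0)
    (hsch : ∀ x0 x1 y0 y1 : ℝ, (c → x1 = 0 ∧ y1 = 0) →
      (∫ t in a..b, (l * B1 * (x0 + t * x1) - l * (A2 + t * B2) * (x0 + t * x1)
          + B2 * (y0 + t * y1) + l * (A1 + t * B1) * (y0 + t * y1)))
        + l * (A1 + a * B1 - p1) * (x0 + a * x1) + (A2 + a * B2 - p2) * (y0 + a * y1)
        = ∫ t in a..b, f t * (y0 + t * y1)) :
    (A1 + b * B1 - u1 b) ^ 2 + (A2 + b * B2 - u2 b) ^ 2 / l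
      + (A1 + a * B1 - (u1 b + (a - b) * s1) - (p1 - u1 a)) ^ 2
      + (A2 + a * B2 - (u2 b + (a - b) * s2) - (p2 - u2 a)) ^ 2 / l
      = (p1 - u1 a) ^ 2 + (p2 - u2 a) ^ 2 / l
      + 2 * ∫ t in a..b,
        ((u2 b + (t - b) * s2 - u2 t) * (A1 + t * B1 - (u1 b + (t - b) * s1))
          - (u1 b + (t - b) * s1 - u1 t) * (A2 + t * B2 - (u2 b + (t - b) * s2))) := by
  have hl' := hl.ne'
  have hu1' : ContinuousOn u1 (Set.uIcc a b) := by rwa [Set.uIcc_of_le hab.le]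
  have hu2' : ContinuousOn u2 (Set.uIcc a b) := by rwa [Set.uIcc_of_le hab.le]
  obtain ⟨x1, hx1⟩ : ∃ x, x = A1 - (u1 b - b * s1) := ⟨_, rfl⟩
  obtain ⟨y1, hy1⟩ : ∃ y, y = B1 - s1 := ⟨_, rfl⟩
  obtain ⟨x2, hx2⟩ : ∃ x, x = A2 - (u2 b - b * s2) := ⟨_, rfl⟩
  obtain ⟨y2, hy2⟩ : ∃ y, y = B2 - s2 := ⟨_, rfl⟩
  have hy : c → y1 = 0 ∧ y2 = 0 := fun h => by
    obtain ⟨⟨h1, h2⟩, h3, h4⟩ := hc h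
    simp [hy1, hy2, h1, h2, h3, h4]
  have C1 := integral_affine_consistency hab hu1 hd1 (hu2'.intervalIntegrable) (s := s1)
    (x := x1) (y := y1) (by
      by_cases h : c
      · exact Or.inl (hy h).1
      · exact Or.inr (hnc h).1)
  have C2 := integral_affine_consistency hab hu2 hd2
    (hf.sub (ContinuousOn.intervalIntegrable (by fun_prop))) (s := s2)
    (x := x2) (y := y2) (by
      by_cases h : c
      · exact Or.inl (hy h).2
      · exact Or.inr (hnc h).2)
  have F1 := integral_slope_mul_affine a b x1 y1
  have F2 := integral_slope_mul_affine a b x2 y2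
  have S := hsch (x1 / l) (y1 / l) (x2 / l) (y2 / l) (fun h => by
    obtain ⟨h1, h2⟩ := hy h
    simp [h1, h2])
  have i0 : ∀ s x y : ℝ, IntervalIntegrable (fun t => s * (x + t * y)) volume a b :=
    fun s x y => Continuous.intervalIntegrable (by fun_prop) _ _
  have i1 : ∀ z s x y : ℝ, IntervalIntegrable (fun t => (z + (t - b) * s) * (x + t * y)) volume a b :=
    fun z s x y => Continuous.intervalIntegrable (by fun_prop) _ _
  have i2 : ∀ x y : ℝ, IntervalIntegrable (fun t => f t * (x + t * y)) volume a b :=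
    fun x y => hf.mul_continuousOn (by fun_prop)
  have i3 : ∀ x y : ℝ, IntervalIntegrable (fun t => u1 t * (x + t * y)) volume a b :=
    fun x y => ContinuousOn.intervalIntegrable (by fun_prop)
  have i4 : ∀ x y : ℝ, IntervalIntegrable (fun t => u2 t * (x + t * y)) volume a b :=
    fun x y => ContinuousOn.intervalIntegrable (by fun_prop)
  have E1 : (∫ t in a..b, (l * B1 * (x1 / l + t * (y1 / l))
        - l * (A2 + t * B2) * (x1 / l + t * (y1 / l))
        + B2 * (x2 / l + t * (y2 / l)) + l * (A1 + t * B1) * (x2 / l + t * (y2 / l))))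
      = (∫ t in a..b, y1 * (x1 + t * y1)) + (∫ t in a..b, s1 * (x1 + t * y1))
        - (∫ t in a..b, (u2 b + (t - b) * s2) * (x1 + t * y1))
        + l⁻¹ * (∫ t in a..b, y2 * (x2 + t * y2)) + l⁻¹ * (∫ t in a..b, s2 * (x2 + t * y2))
        + ∫ t in a..b, (u1 b + (t - b) * s1) * (x2 + t * y2) := by
    rw [← intervalIntegral.integral_const_mul, ← intervalIntegral.integral_const_mul,
      ← intervalIntegral.integral_add (i0 _ _ _) (i0 _ _ _),
      ← intervalIntegral.integral_sub ((i0 _ _ _).add (i0 _ _ _)) (i1 _ _ _ _),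
      ← intervalIntegral.integral_add (((i0 _ _ _).add (i0 _ _ _)).sub (i1 _ _ _ _))
        ((i0 _ _ _).const_mul _),
      ← intervalIntegral.integral_add ((((i0 _ _ _).add (i0 _ _ _)).sub (i1 _ _ _ _)).add
        ((i0 _ _ _).const_mul _)) ((i0 _ _ _).const_mul _),
      ← intervalIntegral.integral_add (((((i0 _ _ _).add (i0 _ _ _)).sub (i1 _ _ _ _)).add
        ((i0 _ _ _).const_mul _)).add ((i0 _ _ _).const_mul _)) (i1 _ _ _ _)]
    congr 1
    funext t
    rw [hx1, hx2, hy1, hy2]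
    field_simp
    ring
  have E2 : ∫ t in a..b, f t * (x2 / l + t * (y2 / l)) = l⁻¹ * ∫ t in a..b, f t * (x2 + t * y2) := by
    rw [← intervalIntegral.integral_const_mul]
    congr 1
    funext t
    field_simp
  have E3 : ∫ t in a..b, (f t - l * u1 t) * (x2 + t * y2)
      = (∫ t in a..b, f t * (x2 + t * y2)) - l * ∫ t in a..b, u1 t * (x2 + t * y2) := by
    rw [← intervalIntegral.integral_const_mul,
      ← intervalIntegral.integral_sub (i2 _ _) ((i3 _ _).const_mul _)]
    congr 1
    funext t
    ring
  have E4 : ∫ t in a..b,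
        ((u2 b + (t - b) * s2 - u2 t) * (A1 + t * B1 - (u1 b + (t - b) * s1))
          - (u1 b + (t - b) * s1 - u1 t) * (A2 + t * B2 - (u2 b + (t - b) * s2)))
      = (∫ t in a..b, (u2 b + (t - b) * s2) * (x1 + t * y1)) - (∫ t in a..b, u2 t * (x1 + t * y1))
        - ((∫ t in a..b, (u1 b + (t - b) * s1) * (x2 + t * y2))
          - ∫ t in a..b, u1 t * (x2 + t * y2)) := by
    rw [← intervalIntegral.integral_sub (i1 _ _ _ _) (i4 _ _),
      ← intervalIntegral.integral_sub (i1 _ _ _ _) (i3 _ _),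
      ← intervalIntegral.integral_sub ((i1 _ _ _ _).sub (i4 _ _)) ((i1 _ _ _ _).sub (i3 _ _))]
    congr 1
    funext t
    rw [hx1, hx2, hy1, hy2]
    ring
  rw [E1, E2, F1, F2] at S
  rw [E3] at C2
  rw [E4]
  have hF : ∫ t in a..b, f t * (x2 + t * y2) = (∫ t in a..b, s2 * (x2 + t * y2))
      + (u2 b + (a - b) * s2 - u2 a) * (x2 + a * y2) + l * ∫ t in a..b, u1 t * (x2 + t * y2) := by
    linarith
  rw [hF] at S
  rw [← C1]
  generalize (∫ t in a..b, s2 * (x2 + t * y2)) = J1 at *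
  generalize (∫ t in a..b, s1 * (x1 + t * y1)) = J2 at *
  generalize (∫ t in a..b, (u2 b + (t - b) * s2) * (x1 + t * y1)) = J3 at *
  generalize (∫ t in a..b, (u1 b + (t - b) * s1) * (x2 + t * y2)) = J4 at *
  generalize (∫ t in a..b, u1 t * (x2 + t * y2)) = J5 at *
  have hJ : J3 - J4 + J5 = ((x1 + b * y1) ^ 2 - (x1 + a * y1) ^ 2) / 2 + J2
      + l⁻¹ * (((x2 + b * y2) ^ 2 - (x2 + a * y2) ^ 2) / 2)
      + l * (A1 + a * B1 - p1) * (x1 / l + a * (y1 / l))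
      + (A2 + a * B2 - p2) * (x2 / l + a * (y2 / l))
      - l⁻¹ * ((u2 b + (a - b) * s2 - u2 a) * (x2 + a * y2)) := by
    have : l⁻¹ * (l * J5) = J5 := by field_simp
    linear_combination -S - this
  have hfin : J3 - (J2 + (u1 b + (a - b) * s1 - u1 a) * (x1 + a * y1)) - (J4 - J5)
    = (J3 - J4 + J5) - (J2 + (u1 b + (a - b) * s1 - u1 a) * (x1 + a * y1)) := by ring
  rw [hfin, hJ, hx1, hx2, hy1, hy2]
  field_simp
  ring

/-- Discrete stability: a telescoping energy inequality controls nodal values `x` and the values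
`y` after the jumps `j`. -/
lemma energy_stability (N : ℕ) (x y j g : ℕ → ℝ) (hx0 : x 0 = 0) (hx : ∀ n, 0 ≤ x n)
    (hy : ∀ n, 0 ≤ y n) (hg : ∀ n, 1 ≤ n → n ≤ N → 0 ≤ g n)
    (hyj : ∀ n, 1 ≤ n → n ≤ N → y n ≤ x (n - 1) + j n)
    (hen : ∀ n, 1 ≤ n → n ≤ N →
      x n ^ 2 + j n ^ 2 ≤ x (n - 1) ^ 2 + 2 * (g n * max (x n) (y n)))
    (n : ℕ) (hn : 1 ≤ n) (hnN : n ≤ N) :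
    x n ≤ 8 * ∑ m ∈ Finset.Icc 1 N, g m ∧ y n ≤ 8 * ∑ m ∈ Finset.Icc 1 N, g m := by
  obtain ⟨m0, hm0, hmax⟩ := Finset.exists_max_image (Finset.Icc 1 N)
    (fun n => max (x n) (y n)) ⟨n, Finset.mem_Icc.2 ⟨hn, hnN⟩⟩
  rw [Finset.mem_Icc] at hm0
  set S := max (x m0) (y m0) with hS
  set G := ∑ m ∈ Finset.Icc 1 N, g m with hG
  have hS0 : 0 ≤ S := le_max_of_le_left (hx m0)
  have hG0 : 0 ≤ G := Finset.sum_nonneg fun m hm =>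
    hg m (Finset.mem_Icc.1 hm).1 (Finset.mem_Icc.1 hm).2
  have hxS : ∀ n, 1 ≤ n → n ≤ N → max (x n) (y n) ≤ S :=
    fun n h1 h2 => hmax n (Finset.mem_Icc.2 ⟨h1, h2⟩)
  have hpart : ∀ n, n ≤ N → ∑ m ∈ Finset.Icc 1 n, g m ≤ G := fun n h =>
    Finset.sum_le_sum_of_subset_of_nonneg (Finset.Icc_subset_Icc_right h) fun m hm _ =>
      hg m (Finset.mem_Icc.1 hm).1 (Finset.mem_Icc.1 hm).2
  have hen' : ∀ n, 1 ≤ n → n ≤ N → x n ^ 2 + j n ^ 2 ≤ x (n - 1) ^ 2 + 2 * (g n * S) := by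
    intro n h1 h2
    have := mul_le_mul_of_nonneg_left (hxS n h1 h2) (hg n h1 h2)
    linarith [hen n h1 h2]
  have htel : ∀ n, n ≤ N → x n ^ 2 ≤ 2 * ((∑ m ∈ Finset.Icc 1 n, g m) * S) := by
    intro n
    induction n with
    | zero => intro _; simp [hx0]
    | succ n ih =>
      intro h
      have h1 := hen' (n + 1) (by omega) h
      have h2 := ih (by omega)
      rw [Finset.sum_Icc_succ_top (by omega)]
      simp only [Nat.add_sub_cancel] at h1
      nlinarith [sq_nonneg (j (n + 1))]
  have hxG : ∀ n, n ≤ N → x n ^ 2 ≤ 2 * (G * S) := fun n h =>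
    (htel n h).trans (by
      have := mul_le_mul_of_nonneg_right (hpart n h) hS0
      linarith)
  have hyG : ∀ n, 1 ≤ n → n ≤ N → y n ^ 2 ≤ 8 * (G * S) := by
    intro n h1 h2
    have h3 := hen' n h1 h2
    have h4 := htel (n - 1) (by omega)
    have h5 : (∑ m ∈ Finset.Icc 1 (n - 1), g m) + g n ≤ G := by
      obtain ⟨k, rfl⟩ : ∃ k, n = k + 1 := ⟨n - 1, by omega⟩
      have := hpart (k + 1) h2
      rwa [Finset.sum_Icc_succ_top (by omega)] at this
    have h6 := mul_le_mul_of_nonneg_right h5 hS0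
    have h7 : j n ^ 2 ≤ 2 * (G * S) := by nlinarith [sq_nonneg (x n)]
    have h8 := hxG (n - 1) (by omega)
    have h9 : y n ^ 2 ≤ (x (n - 1) + j n) ^ 2 := pow_le_pow_left₀ (hy n) (hyj n h1 h2) 2
    nlinarith [sq_nonneg (x (n - 1) - j n)]
  have hSS : S ^ 2 ≤ 8 * (G * S) := by
    rcases max_choice (x m0) (y m0) with h | h
    · have h1 := hxG m0 hm0.2
      have h2 : 0 ≤ G * S := mul_nonneg hG0 hS0
      rw [← h, ← hS] at h1
      linarith
    · have h1 := hyG m0 hm0.1 hm0.2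
      rwa [← h, ← hS] at h1
  have hfin : S ≤ 8 * G := by
    rcases hS0.eq_or_lt with h | h
    · rw [← h]; positivity
    · nlinarith
  exact ⟨(le_max_left _ _).trans ((hxS n hn hnN).trans hfin),
    (le_max_right _ _).trans ((hxS n hn hnN).trans hfin)⟩

lemma pval_eq_affine {H : Type*} [NormedAddCommGroup H] [InnerProductSpace ℝ H] {q : ℕ}
    (hq : q = 0 ∨ q = 1) (c : ℕ → ℕ → H) (n : ℕ) (s : ℝ) :
    pval q c n s = c n 0 + s • (if q = 0 then 0 else c n 1) := by
  rcases hq with rfl | rfl <;> simp [pval, Finset.sum_range_succ]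

lemma pderiv_eq_slope {H : Type*} [NormedAddCommGroup H] [InnerProductSpace ℝ H] {q : ℕ}
    (hq : q = 0 ∨ q = 1) (c : ℕ → ℕ → H) (n : ℕ) (s : ℝ) :
    pderiv q c n s = if q = 0 then 0 else c n 1 := by
  rcases hq with rfl | rfl <;> simp [pderiv, Finset.sum_range_succ]

lemma inner_smul_mode {H : Type*} [NormedAddCommGroup H] [InnerProductSpace ℝ H]
    {φ : ℕ → H} (hφ : Orthonormal ℝ φ) (x : ℝ) (i k : ℕ) :
    ⟪x • φ k, φ i⟫ = if i = k then x else 0 := by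
  rw [real_inner_smul_left, orthonormal_iff_ite.mp hφ k i]
  by_cases h : i = k
  · simp [h]
  · simp [h, Ne.symm h]

lemma aForm_smul_mode {H : Type*} [NormedAddCommGroup H] [InnerProductSpace ℝ H]
    {φ : ℕ → H} (hφ : Orthonormal ℝ φ) (lam : ℕ → ℝ) (u : H) (x : ℝ) (k : ℕ) :
    aForm φ lam u (x • φ k) = lam k * ⟪u, φ k⟫ * x := by
  unfold aForm aPow
  rw [tsum_eq_single k]
  · rw [inner_smul_mode hφ]; simp
  · intro i hi
    rw [inner_smul_mode hφ]; simp [hi]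

lemma aForm_zero_right {H : Type*} [NormedAddCommGroup H] [InnerProductSpace ℝ H]
    (φ : ℕ → H) (lam : ℕ → ℝ) (u : H) : aForm φ lam u 0 = 0 := by
  simp [aForm, aPow]

lemma memHs_zero {H : Type*} [NormedAddCommGroup H] [InnerProductSpace ℝ H]
    (φ : ℕ → H) (lam : ℕ → ℝ) (α : ℝ) : MemHs φ lam α 0 := by
  simp [MemHs, summable_zero]

lemma memHs_smul_mode {H : Type*} [NormedAddCommGroup H] [InnerProductSpace ℝ H]
    {φ : ℕ → H} (hφ : Orthonormal ℝ φ) (lam : ℕ → ℝ) (α x : ℝ) (k : ℕ) :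
    MemHs φ lam α (x • φ k) := by
  refine summable_of_ne_finset_zero (s := {k}) fun i hi => ?_
  rw [inner_smul_mode hφ]
  simp [Finset.mem_singleton.not.mp hi]

lemma inner_Aop_mode {H : Type*} [NormedAddCommGroup H] [InnerProductSpace ℝ H] [CompleteSpace H]
    {φ : ℕ → H} (hφ : Orthonormal ℝ φ) (lam : ℕ → ℝ)
    {v : H} (hv : MemHs φ lam 2 v) (k : ℕ) : ⟪Aop φ lam v, φ k⟫ = lam k * ⟪v, φ k⟫ := by
  have hs : Summable fun i => (lam i * ⟪v, φ i⟫) • φ i := by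
    have h := (hφ.orthogonalFamily.summable_iff_norm_sq_summable
      (fun i => lam i * ⟪v, φ i⟫)).2 (by
        refine hv.congr fun i => ?_
        rw [Real.norm_eq_abs, sq_abs, mul_pow]
        norm_cast)
    simpa using h
  have h1 : HasSum (fun i => ⟪φ k, (lam i * ⟪v, φ i⟫) • φ i⟫) ⟪φ k, Aop φ lam v⟫ :=
    hs.hasSum.mapL (innerSL ℝ (φ k))
  have h2 : HasSum (fun i => ⟪φ k, (lam i * ⟪v, φ i⟫) • φ i⟫) (lam k * ⟪v, φ k⟫) := by
    convert hasSum_single k ?_ using 1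
    · rw [real_inner_smul_right, real_inner_self_eq_norm_sq, hφ.1 k, one_pow, mul_one]
    · intro i hi
      rw [real_inner_smul_right, hφ.2 hi.symm, mul_zero]
  rw [real_inner_comm, h1.unique h2]

/-- The dG equations tested with a function supported on one subinterval and one mode. -/
lemma dG_scheme_mode {H : Type*} [NormedAddCommGroup H] [InnerProductSpace ℝ H]
    {φ : ℕ → H} (hφ : Orthonormal ℝ φ) (lam : ℕ → ℝ) {q : ℕ} (hq : q = 0 ∨ q = 1)
    {N : ℕ} {tt : ℕ → ℝ} {f : ℝ → H} {u0 v0 : H} {c1 c2 : ℕ → ℕ → H}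
    (hsch : ∀ d1 d2 : ℕ → ℕ → H, (∀ n j, MemHs φ lam 1 (d1 n j)) →
        (∀ n j, MemHs φ lam 1 (d2 n j)) →
        Bform φ lam tt N q c1 c2 d1 d2 =
          (∑ n ∈ Finset.Icc 1 N, ∫ s in tt (n-1)..tt n, ⟪f s, pval q d2 n s⟫)
            + aForm φ lam u0 (pval q d1 1 (tt 0)) + ⟪v0, pval q d2 1 (tt 0)⟫)
    (k n : ℕ) (hn : 1 ≤ n) (hnN : n ≤ N) (x0 x1 y0 y1 : ℝ) (hxy : q = 0 → x1 = 0 ∧ y1 = 0) :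
    (∫ s in tt (n-1)..tt n,
        (lam k * ⟪pderiv q c1 n s, φ k⟫ * (x0 + s * x1)
          - lam k * ⟪pval q c2 n s, φ k⟫ * (x0 + s * x1)
          + ⟪pderiv q c2 n s, φ k⟫ * (y0 + s * y1)
          + lam k * ⟪pval q c1 n s, φ k⟫ * (y0 + s * y1)))
      + lam k * ⟪pval q c1 n (tt (n-1)) - (if n = 1 then u0 else pval q c1 (n-1) (tt (n-1))), φ k⟫
        * (x0 + tt (n-1) * x1)
      + ⟪pval q c2 n (tt (n-1)) - (if n = 1 then v0 else pval q c2 (n-1) (tt (n-1))), φ k⟫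
        * (y0 + tt (n-1) * y1)
      = ∫ s in tt (n-1)..tt n, ⟪f s, φ k⟫ * (y0 + s * y1) := by
  set d : ℝ → ℝ → ℕ → ℕ → H :=
    fun z0 z1 m j => if m = n then (if j = 0 then z0 else z1) • φ k else 0 with hd
  have hdmem : ∀ z0 z1 m j, MemHs φ lam 1 (d z0 z1 m j) := by
    intro z0 z1 m j
    simp only [hd]
    split_ifs
    · exact memHs_smul_mode hφ lam 1 _ k
    · exact memHs_smul_mode hφ lam 1 _ k
    · exact memHs_zero φ lam 1
  have hdval : ∀ z0 z1 s, (q = 0 → z1 = 0) → pval q (d z0 z1) n s = (z0 + s * z1) • φ k := by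
    intro z0 z1 s hz
    rw [pval_eq_affine hq]
    rcases hq with rfl | rfl
    · simp [hd, hz]
    · simp [hd, add_smul, smul_smul]
  have hdval0 : ∀ z0 z1 s m, m ≠ n → pval q (d z0 z1) m s = 0 := by
    intro z0 z1 s m hm
    simp [pval, hd, hm]
  have hx : q = 0 → x1 = 0 := fun h => (hxy h).1
  have hy : q = 0 → y1 = 0 := fun h => (hxy h).2
  have h := hsch (d x0 x1) (d y0 y1) (hdmem x0 x1) (hdmem y0 y1)
  unfold Bform at h
  rw [Finset.sum_eq_single_of_mem n (Finset.mem_Icc.2 ⟨hn, hnN⟩) (by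
      intro m _ hm
      simp [hdval0 _ _ _ m hm, aForm_zero_right]),
    Finset.sum_eq_single_of_mem (s := Finset.Icc 1 N) n (Finset.mem_Icc.2 ⟨hn, hnN⟩) (by
      intro m _ hm
      simp [hdval0 _ _ _ m hm])] at h
  simp only [hdval _ _ _ hx, hdval _ _ _ hy, aForm_smul_mode hφ, real_inner_smul_right] at h
  rcases eq_or_ne n 1 with rfl | hn1
  · rw [Finset.sum_eq_zero (by
      intro m hm
      rw [Finset.mem_Icc] at hm
      have : m + 1 ≠ 1 := by omega
      simp [hdval0 _ _ _ _ this, aForm_zero_right])] at h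
    simp only [hdval _ _ _ hx, hdval _ _ _ hy, aForm_smul_mode hφ, real_inner_smul_right] at h
    simp only [if_true, inner_sub_left]
    simp only [Nat.sub_self] at h ⊢
    simp only [mul_comm _ (⟪f _, φ k⟫), mul_comm _ (⟪pderiv q c2 _ _, φ k⟫)] at h
    linear_combination h
  · have hn2 : n - 1 + 1 = n := by omega
    rw [Finset.sum_eq_single_of_mem (n - 1) (Finset.mem_Icc.2 ⟨by omega, by omega⟩) (by
      intro m _ hm
      have : m + 1 ≠ n := by omega
      simp [hdval0 _ _ _ _ this, aForm_zero_right])] at h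
    simp only [hn2, hdval0 _ _ _ _ hn1.symm, hdval _ _ _ hx, hdval _ _ _ hy, aForm_smul_mode hφ,
      real_inner_smul_right, aForm_zero_right, inner_zero_right, add_zero] at h
    simp only [if_neg hn1, inner_sub_left] at h ⊢
    simp only [mul_comm _ (⟪f _, φ k⟫), mul_comm _ (⟪pderiv q c2 _ _, φ k⟫)] at h
    linear_combination h

/-- The first `K` spectral coefficients, weighted by `w`. -/
def modeMap {H : Type*} [NormedAddCommGroup H] [InnerProductSpace ℝ H]
    (φ : ℕ → H) (w : ℕ → ℝ) (K : ℕ) : H →L[ℝ] EuclideanSpace ℝ (Fin K) :=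
  (EuclideanSpace.equiv (Fin K) ℝ).symm.toContinuousLinearMap ∘L
    ContinuousLinearMap.pi fun i : Fin K => w i • innerSL ℝ (φ i)

lemma modeMap_apply {H : Type*} [NormedAddCommGroup H] [InnerProductSpace ℝ H]
    (φ : ℕ → H) (w : ℕ → ℝ) (K : ℕ) (v : H) (i : Fin K) :
    modeMap φ w K v i = w i * ⟪v, φ i⟫ := by
  simp [modeMap, real_inner_comm]

lemma norm_sq_modeMap {H : Type*} [NormedAddCommGroup H] [InnerProductSpace ℝ H]
    (φ : ℕ → H) (w : ℕ → ℝ) (K : ℕ) (v : H) :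
    ‖modeMap φ w K v‖ ^ 2 = ∑ i : Fin K, w i ^ 2 * ⟪v, φ i⟫ ^ 2 := by
  rw [EuclideanSpace.norm_sq_eq]
  simp [modeMap_apply, mul_pow]

lemma norm_modeMap_one_le {H : Type*} [NormedAddCommGroup H] [InnerProductSpace ℝ H]
    {φ : ℕ → H} (hφ : Orthonormal ℝ φ) (K : ℕ) (v : H) : ‖modeMap φ 1 K v‖ ≤ ‖v‖ := by
  refine le_of_sq_le_sq ?_ (norm_nonneg v)
  rw [norm_sq_modeMap, Fin.sum_univ_eq_sum_range (fun i => (1 : ℕ → ℝ) i ^ 2 * ⟪v, φ i⟫ ^ 2)]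
  simpa [real_inner_comm] using hφ.sum_inner_products_le v (s := Finset.range K)

lemma norm_modeMap_sqrt_le {H : Type*} [NormedAddCommGroup H] [InnerProductSpace ℝ H]
    (φ : ℕ → H) {lam : ℕ → ℝ} (hlam : ∀ k, 0 < lam k) (K : ℕ) {v : H} (hv : MemHs φ lam 1 v) :
    ‖modeMap φ (fun k => √(lam k)) K v‖ ≤ hsNorm φ lam 1 v := by
  refine Real.le_sqrt_of_sq_le ?_
  rw [norm_sq_modeMap, Fin.sum_univ_eq_sum_range (fun i => √(lam i) ^ 2 * ⟪v, φ i⟫ ^ 2)]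
  have h : ∀ i, √(lam i) ^ 2 * ⟪v, φ i⟫ ^ 2 = lam i ^ (1 : ℝ) * ⟪v, φ i⟫ ^ 2 := fun i => by
    rw [Real.sq_sqrt (hlam i).le, Real.rpow_one]
  simp only [h]
  exact hv.sum_le_tsum _ fun i _ => by have := hlam i; positivity

lemma norm_le_of_norm_modeMap_le {H : Type*} [NormedAddCommGroup H] [InnerProductSpace ℝ H]
    [CompleteSpace H] {φ : ℕ → H} (hφ : Orthonormal ℝ φ)
    (hφtotal : (Submodule.span ℝ (Set.range φ)).topologicalClosure = ⊤) {v : H} {G : ℝ}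
    (h : ∀ K, ‖modeMap φ 1 K v‖ ≤ G) : ‖v‖ ≤ G := by
  have hG : 0 ≤ G := (norm_nonneg _).trans (h 0)
  refine le_of_sq_le_sq ?_ hG
  have hs := (HilbertBasis.mk hφ hφtotal.ge).hasSum_inner_mul_inner v v
  rw [real_inner_self_eq_norm_sq] at hs
  refine le_of_tendsto' hs.tendsto_sum_nat fun K => ?_
  have h1 := pow_le_pow_left₀ (norm_nonneg _) (h K) 2
  rw [norm_sq_modeMap, Fin.sum_univ_eq_sum_range (fun i => (1 : ℕ → ℝ) i ^ 2 * ⟪v, φ i⟫ ^ 2)] at h1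
  refine le_trans (le_of_eq (Finset.sum_congr rfl fun i _ => ?_)) h1
  simp only [HilbertBasis.coe_mk, Pi.one_apply]
  rw [real_inner_comm v (φ i)]
  ring

/-- The pair `(v₁, v₂)` truncated to `K` modes, with the norm of `H × Ḣ⁻¹`. -/
def energyMap {H : Type*} [NormedAddCommGroup H] [InnerProductSpace ℝ H]
    (φ : ℕ → H) (lam : ℕ → ℝ) (K : ℕ) (v1 v2 : H) :
    WithLp 2 (EuclideanSpace ℝ (Fin K) × EuclideanSpace ℝ (Fin K)) :=
  WithLp.toLp 2 (modeMap φ 1 K v1, modeMap φ (fun k => (√(lam k))⁻¹) K v2)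

lemma energyMap_sub {H : Type*} [NormedAddCommGroup H] [InnerProductSpace ℝ H]
    (φ : ℕ → H) (lam : ℕ → ℝ) (K : ℕ) (v1 v2 w1 w2 : H) :
    energyMap φ lam K (v1 - w1) (v2 - w2) = energyMap φ lam K v1 v2 - energyMap φ lam K w1 w2 := by
  simp [energyMap, ← WithLp.toLp_sub]

lemma energyMap_add_smul {H : Type*} [NormedAddCommGroup H] [InnerProductSpace ℝ H]
    (φ : ℕ → H) (lam : ℕ → ℝ) (K : ℕ) (a b : ℝ) (v1 v2 w1 w2 : H) :
    energyMap φ lam K (a • v1 + b • w1) (a • v2 + b • w2)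
      = a • energyMap φ lam K v1 v2 + b • energyMap φ lam K w1 w2 := by
  simp [energyMap, ← WithLp.toLp_add, ← WithLp.toLp_smul]

lemma norm_sq_energyMap {H : Type*} [NormedAddCommGroup H] [InnerProductSpace ℝ H]
    (φ : ℕ → H) {lam : ℕ → ℝ} (hlam : ∀ k, 0 < lam k) (K : ℕ) (v1 v2 : H) :
    ‖energyMap φ lam K v1 v2‖ ^ 2
      = ∑ i : Fin K, (⟪v1, φ i⟫ ^ 2 + ⟪v2, φ i⟫ ^ 2 / lam i) := by
  rw [energyMap, WithLp.prod_norm_sq_eq_of_L2, Finset.sum_add_distrib]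
  rw [WithLp.toLp_fst, WithLp.toLp_snd, norm_sq_modeMap, norm_sq_modeMap]
  congr 1
  · simp
  · refine Finset.sum_congr rfl fun i _ => ?_
    rw [inv_pow, Real.sq_sqrt (hlam i).le, div_eq_inv_mul]

lemma norm_modeMap_le_energyMap {H : Type*} [NormedAddCommGroup H] [InnerProductSpace ℝ H]
    (φ : ℕ → H) (lam : ℕ → ℝ) (K : ℕ) (v1 v2 : H) :
    ‖modeMap φ 1 K v1‖ ≤ ‖energyMap φ lam K v1 v2‖ := by
  refine le_of_sq_le_sq ?_ (norm_nonneg _)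
  rw [energyMap, WithLp.prod_norm_sq_eq_of_L2]
  exact le_add_of_nonneg_right (sq_nonneg _)

/-- Duality estimate between `H × Ḣ¹` and `H × Ḣ⁻¹`, truncated to `K` modes. -/
lemma abs_sum_duality_le {H : Type*} [NormedAddCommGroup H] [InnerProductSpace ℝ H]
    (φ : ℕ → H) {lam : ℕ → ℝ} (hlam : ∀ k, 0 < lam k) (K : ℕ) (r1 r2 v1 v2 : H) :
    |∑ i : Fin K, (⟪r2, φ i⟫ * ⟪v1, φ i⟫ - ⟪r1, φ i⟫ * ⟪v2, φ i⟫)|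
      ≤ (‖modeMap φ 1 K r2‖ + ‖modeMap φ (fun k => √(lam k)) K r1‖)
        * ‖energyMap φ lam K v1 v2‖ := by
  set ρ : WithLp 2 (EuclideanSpace ℝ (Fin K) × EuclideanSpace ℝ (Fin K)) :=
    WithLp.toLp 2 (modeMap φ 1 K r2, -modeMap φ (fun k => √(lam k)) K r1) with hρ
  have h1 : ∑ i : Fin K, (⟪r2, φ i⟫ * ⟪v1, φ i⟫ - ⟪r1, φ i⟫ * ⟪v2, φ i⟫)
      = ⟪ρ, energyMap φ lam K v1 v2⟫ := by
    rw [hρ, energyMap, WithLp.prod_inner_apply]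
    simp only [inner_neg_left, PiLp.inner_apply, modeMap_apply]
    rw [← sub_eq_add_neg, ← Finset.sum_sub_distrib]
    refine Finset.sum_congr rfl fun i _ => ?_
    have : √(lam i) ≠ 0 := (Real.sqrt_pos.2 (hlam i)).ne'
    simp
    field_simp
  have h2 : ‖ρ‖ ≤ ‖modeMap φ 1 K r2‖ + ‖modeMap φ (fun k => √(lam k)) K r1‖ := by
    refine le_of_sq_le_sq ?_ (by positivity)
    rw [hρ, WithLp.prod_norm_sq_eq_of_L2]
    rw [WithLp.toLp_fst, WithLp.toLp_snd, norm_neg]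
    nlinarith [norm_nonneg (modeMap φ 1 K r2),
      norm_nonneg (modeMap φ (fun k => √(lam k)) K r1)]
  rw [h1]
  exact (abs_real_inner_le_norm _ _).trans (by gcongr)

lemma inner_dgProj {H : Type*} [NormedAddCommGroup H] [InnerProductSpace ℝ H] [CompleteSpace H]
    (q : ℕ) (a b : ℝ) (w : ℝ → H) (t : ℝ) (e : H) :
    ⟪dgProj q a b w t, e⟫ = ⟪w b, e⟫ + (t - b) * ⟪dgSlope q a b w, e⟫ := by
  rw [dgProj, inner_add_left, real_inner_smul_left]

lemma integral_inner_dgProj_sub {H : Type*} [NormedAddCommGroup H] [InnerProductSpace ℝ H]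
    [CompleteSpace H] {q : ℕ} (hq : q ≠ 0) {a b : ℝ} (hab : a < b) {w : ℝ → H}
    (hw : ContinuousOn w (Set.Icc a b)) (e : H) :
    ∫ t in a..b, (⟪w b, e⟫ + (t - b) * ⟪dgSlope q a b w, e⟫ - ⟪w t, e⟫) = 0 := by
  have hi : IntervalIntegrable (fun t => dgProj q a b w t - w t) volume a b :=
    ((continuous_dgProj q a b w).intervalIntegrable _ _).sub
      (ContinuousOn.intervalIntegrable (by rwa [Set.uIcc_of_le hab.le]))
  have h := (innerSL ℝ e).intervalIntegral_comp_comm hi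
  rw [integral_dgProj_sub hq hab hw, map_zero] at h
  rw [← h]
  congr 1
  funext t
  rw [innerSL_apply_apply, real_inner_comm _ e, inner_sub_left, inner_dgProj]

lemma norm_energyMap_affine_le {H : Type*} [NormedAddCommGroup H] [InnerProductSpace ℝ H]
    (φ : ℕ → H) (lam : ℕ → ℝ) (K : ℕ) {θ1 θ2 : ℝ → H} {x1 y1 x2 y2 : H}
    (h1 : ∀ t, θ1 t = x1 + t • y1) (h2 : ∀ t, θ2 t = x2 + t • y2) {a b t : ℝ} (hab : a < b)
    (ht : t ∈ Set.Icc a b) :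
    ‖energyMap φ lam K (θ1 t) (θ2 t)‖
      ≤ max ‖energyMap φ lam K (θ1 b) (θ2 b)‖ ‖energyMap φ lam K (θ1 a) (θ2 a)‖ := by
  have hh : b - a ≠ 0 := by linarith
  have hh' : 0 < b - a := by linarith
  set r := (t - a) / (b - a) with hr
  have hr0 : 0 ≤ r := div_nonneg (by linarith [ht.1]) hh'.le
  have hr1 : r ≤ 1 := (div_le_one hh').2 (by linarith [ht.2])
  have ht' : t = r * b + (1 - r) * a := by rw [hr]; field_simp; ring
  have e1 : θ1 t = r • θ1 b + (1 - r) • θ1 a := by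
    rw [h1, h1, h1, ht']; module
  have e2 : θ2 t = r • θ2 b + (1 - r) • θ2 a := by
    rw [h2, h2, h2, ht']; module
  rw [e1, e2, energyMap_add_smul]
  refine (norm_add_le _ _).trans ?_
  rw [norm_smul, norm_smul, Real.norm_of_nonneg hr0, Real.norm_of_nonneg (by linarith : 0 ≤ 1 - r)]
  have m1 := mul_le_mul_of_nonneg_left (le_max_left ‖energyMap φ lam K (θ1 b) (θ2 b)‖
    ‖energyMap φ lam K (θ1 a) (θ2 a)‖) hr0
  have m2 := mul_le_mul_of_nonneg_left (le_max_right ‖energyMap φ lam K (θ1 b) (θ2 b)‖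
    ‖energyMap φ lam K (θ1 a) (θ2 a)‖) (by linarith : 0 ≤ 1 - r)
  linarith

/-- The difference of an affine function and a dG projection is affine. -/
lemma affine_sub_dgProj {H : Type*} [NormedAddCommGroup H] [InnerProductSpace ℝ H]
    (q : ℕ) (a b : ℝ) (w : ℝ → H) (A B : H) (t : ℝ) :
    A + t • B - dgProj q a b w t
      = (A - w b + b • dgSlope q a b w) + t • (B - dgSlope q a b w) := by
  rw [dgProj]
  module

/-- Energy inequality on one subinterval, truncated to `K` modes. -/
lemma interval_energy_le {H : Type*} [NormedAddCommGroup H] [InnerProductSpace ℝ H]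
    [CompleteSpace H] {φ : ℕ → H} {lam : ℕ → ℝ} (hφ : Orthonormal ℝ φ) (hlam : ∀ k, 0 < lam k)
    (q K : ℕ) {a b g : ℝ} (hab : a < b) {f u1 u2 : ℝ → H}
    (hf : IntervalIntegrable f volume a b)
    (hu1 : ContinuousOn u1 (Set.Icc a b)) (hu2 : ContinuousOn u2 (Set.Icc a b))
    (hmem : ∀ t, MemHs φ lam 2 (u1 t))
    (hd1 : ∀ t ∈ Set.Ioo a b, HasDerivAt u1 (u2 t) t)
    (hd2 : ∀ t ∈ Set.Ioo a b, HasDerivAt u2 (f t - Aop φ lam (u1 t)) t)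
    {A1 B1 A2 B2 p1 p2 : H} (hB : q = 0 → B1 = 0 ∧ B2 = 0)
    (hsch : ∀ (k : ℕ) (x0 x1 y0 y1 : ℝ), (q = 0 → x1 = 0 ∧ y1 = 0) →
      (∫ t in a..b, (lam k * ⟪B1, φ k⟫ * (x0 + t * x1)
          - lam k * (⟪A2, φ k⟫ + t * ⟪B2, φ k⟫) * (x0 + t * x1)
          + ⟪B2, φ k⟫ * (y0 + t * y1) + lam k * (⟪A1, φ k⟫ + t * ⟪B1, φ k⟫) * (y0 + t * y1)))
        + lam k * (⟪A1, φ k⟫ + a * ⟪B1, φ k⟫ - ⟪p1, φ k⟫) * (x0 + a * x1)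
        + (⟪A2, φ k⟫ + a * ⟪B2, φ k⟫ - ⟪p2, φ k⟫) * (y0 + a * y1)
        = ∫ t in a..b, ⟪f t, φ k⟫ * (y0 + t * y1))
    (hg : ∀ t ∈ Set.Icc a b, ‖modeMap φ 1 K (dgProj q a b u2 t - u2 t)‖
      + ‖modeMap φ (fun k => √(lam k)) K (dgProj q a b u1 t - u1 t)‖ ≤ g)
    {θ1 θ2 : ℝ → H} (hθ1 : ∀ t, θ1 t = A1 + t • B1 - dgProj q a b u1 t)
    (hθ2 : ∀ t, θ2 t = A2 + t • B2 - dgProj q a b u2 t) :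
    ‖energyMap φ lam K (θ1 b) (θ2 b)‖ ^ 2
      + ‖energyMap φ lam K (θ1 a) (θ2 a) - energyMap φ lam K (p1 - u1 a) (p2 - u2 a)‖ ^ 2
      ≤ ‖energyMap φ lam K (p1 - u1 a) (p2 - u2 a)‖ ^ 2
        + 2 * ((b - a) * g * max ‖energyMap φ lam K (θ1 b) (θ2 b)‖
          ‖energyMap φ lam K (θ1 a) (θ2 a)‖) := by
  have hin : ∀ {w : ℝ → H} (e : H), ContinuousOn w (Set.Icc a b) →
      ContinuousOn (fun t => ⟪w t, e⟫) (Set.Icc a b) := fun e h => h.inner continuousOn_const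
  have hder : ∀ {w : ℝ → H} {w' : H} {t : ℝ} (e : H), HasDerivAt w w' t →
      HasDerivAt (fun t => ⟪w t, e⟫) ⟪w', e⟫ t := fun {w w' t} e h => by
    simpa using h.inner ℝ (hasDerivAt_const t e)
  have hfi : ∀ e : H, IntervalIntegrable (fun t => ⟪f t, e⟫) volume a b := fun e => by
    have h := (innerSL ℝ e).integrable_comp hf.1
    have h' := (innerSL ℝ e).integrable_comp hf.2
    rw [show (fun t => ⟪f t, e⟫) = fun t => innerSL ℝ e (f t) from
      funext fun t => (real_inner_comm _ _).trans (innerSL_apply_apply _ _ _).symm]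
    exact ⟨h, h'⟩
  have hmode : ∀ k, _ := fun k => mode_energy_identity hab (hlam k) (q = 0)
    (A1 := ⟪A1, φ k⟫) (B1 := ⟪B1, φ k⟫) (A2 := ⟪A2, φ k⟫) (B2 := ⟪B2, φ k⟫)
    (s1 := ⟪dgSlope q a b u1, φ k⟫) (s2 := ⟪dgSlope q a b u2, φ k⟫)
    (p1 := ⟪p1, φ k⟫) (p2 := ⟪p2, φ k⟫) (u1 := fun t => ⟪u1 t, φ k⟫)
    (u2 := fun t => ⟪u2 t, φ k⟫) (f := fun t => ⟪f t, φ k⟫)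
    (hin _ hu1) (hin _ hu2) (fun t ht => hder _ (hd1 t ht))
    (fun t ht => by
      have := hder (φ k) (hd2 t ht)
      rwa [inner_sub_left, inner_Aop_mode hφ lam (hmem t)] at this)
    (hfi _)
    (fun h => by
      obtain ⟨h1, h2⟩ := hB h
      simp [h1, h2, h, dgSlope])
    (fun h => ⟨integral_inner_dgProj_sub h hab hu1 _, integral_inner_dgProj_sub h hab hu2 _⟩)
    (hsch k)
  have hθi1 : ∀ t k, ⟪θ1 t, φ k⟫ = ⟪A1, φ k⟫ + t * ⟪B1, φ k⟫
      - (⟪u1 b, φ k⟫ + (t - b) * ⟪dgSlope q a b u1, φ k⟫) := fun t k => by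
    rw [hθ1, inner_sub_left, inner_dgProj, inner_add_left, real_inner_smul_left]
  have hθi2 : ∀ t k, ⟪θ2 t, φ k⟫ = ⟪A2, φ k⟫ + t * ⟪B2, φ k⟫
      - (⟪u2 b, φ k⟫ + (t - b) * ⟪dgSlope q a b u2, φ k⟫) := fun t k => by
    rw [hθ2, inner_sub_left, inner_dgProj, inner_add_left, real_inner_smul_left]
  set F : ℕ → ℝ → ℝ := fun k t =>
    ⟪dgProj q a b u2 t - u2 t, φ k⟫ * ⟪θ1 t, φ k⟫ - ⟪dgProj q a b u1 t - u1 t, φ k⟫ * ⟪θ2 t, φ k⟫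
    with hF
  have hmode' : ∀ k, (⟪θ1 b, φ k⟫ ^ 2 + ⟪θ2 b, φ k⟫ ^ 2 / lam k)
      + (⟪θ1 a - (p1 - u1 a), φ k⟫ ^ 2 + ⟪θ2 a - (p2 - u2 a), φ k⟫ ^ 2 / lam k)
      = (⟪p1 - u1 a, φ k⟫ ^ 2 + ⟪p2 - u2 a, φ k⟫ ^ 2 / lam k) + 2 * ∫ t in a..b, F k t := by
    intro k
    have h := hmode k
    simp only [hF, inner_sub_left, hθi1, hθi2, inner_dgProj, sub_self, zero_mul, add_zero]
    linarith
  have hFi : ∀ k, IntervalIntegrable (F k) volume a b := fun k => by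
    refine ContinuousOn.intervalIntegrable ?_
    rw [Set.uIcc_of_le hab.le]
    have c1 := (continuous_dgProj q a b u1).continuousOn (s := Set.Icc a b)
    have c2 := (continuous_dgProj q a b u2).continuousOn (s := Set.Icc a b)
    have t1 : ContinuousOn θ1 (Set.Icc a b) := by
      rw [funext hθ1]; fun_prop
    have t2 : ContinuousOn θ2 (Set.Icc a b) := by
      rw [funext hθ2]; fun_prop
    exact ((hin _ (c2.sub hu2)).mul (hin _ t1)).sub ((hin _ (c1.sub hu1)).mul (hin _ t2))
  set S := max ‖energyMap φ lam K (θ1 b) (θ2 b)‖ ‖energyMap φ lam K (θ1 a) (θ2 a)‖ with hS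
  have hg0 : 0 ≤ g := le_trans (by positivity) (hg a (Set.left_mem_Icc.2 hab.le))
  have hIntegral : ∑ i : Fin K, ∫ t in a..b, F i t ≤ (b - a) * g * S := by
    rw [← intervalIntegral.integral_finsetSum (f := fun i : Fin K => F i) fun i _ => hFi i]
    have := intervalIntegral.norm_integral_le_of_norm_le_const (a := a) (b := b)
      (f := fun t => ∑ i : Fin K, F i t) (C := g * S) (fun t ht => by
        rw [Set.uIoc_of_le hab.le] at ht
        have ht' := Set.Ioc_subset_Icc_self ht
        refine (abs_sum_duality_le φ hlam K _ _ _ _).trans ?_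
        refine mul_le_mul (hg t ht') ?_ (norm_nonneg _) hg0
        exact norm_energyMap_affine_le φ lam K
          (fun t => (hθ1 t).trans (affine_sub_dgProj q a b u1 A1 B1 t))
          (fun t => (hθ2 t).trans (affine_sub_dgProj q a b u2 A2 B2 t)) hab ht')
    rw [abs_of_pos (by linarith)] at this
    refine (le_abs_self _).trans (this.trans (le_of_eq (by ring)))
  have hsum : ‖energyMap φ lam K (θ1 b) (θ2 b)‖ ^ 2
      + ‖energyMap φ lam K (θ1 a) (θ2 a) - energyMap φ lam K (p1 - u1 a) (p2 - u2 a)‖ ^ 2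
      = ‖energyMap φ lam K (p1 - u1 a) (p2 - u2 a)‖ ^ 2
        + 2 * ∑ i : Fin K, ∫ t in a..b, F i t := by
    rw [← energyMap_sub, norm_sq_energyMap φ hlam, norm_sq_energyMap φ hlam,
      norm_sq_energyMap φ hlam, ← Finset.sum_add_distrib, Finset.mul_sum,
      ← Finset.sum_add_distrib]
    exact Finset.sum_congr rfl fun i _ => hmode' i
  linarith

lemma mesh_mem {N : ℕ} {T : ℝ} {tt : ℕ → ℝ} (h0 : tt 0 = 0) (hT : tt N = T)
    (hmesh : ∀ n < N, tt n < tt (n + 1)) {n : ℕ} (hn : 1 ≤ n) (hnN : n ≤ N) :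
    0 ≤ tt (n - 1) ∧ tt (n - 1) < tt n ∧ tt n ≤ T := by
  have hmono : ∀ m, m ≤ N → ∀ l ≤ m, tt l ≤ tt m := by
    intro m
    induction m with
    | zero => intro _ l hl; rw [Nat.le_zero.1 hl]
    | succ m ih =>
      intro hm l hl
      rcases Nat.lt_or_ge l (m + 1) with h | h
      · exact (ih (by omega) l (by omega)).trans (hmesh m (by omega)).le
      · rw [le_antisymm hl h]
  refine ⟨h0 ▸ hmono (n - 1) (by omega) 0 (by omega), ?_, hT ▸ hmono N le_rfl n hnN⟩
  have := hmesh (n - 1) (by omega)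
  rwa [Nat.sub_add_cancel hn] at this

lemma exists_mem_mesh_Ioc {N : ℕ} {T : ℝ} {tt : ℕ → ℝ} (h0 : tt 0 = 0) (hT : tt N = T)
    {t : ℝ} (ht : t ∈ Set.Ioo 0 T) :
    ∃ n, 1 ≤ n ∧ n ≤ N ∧ t ∈ Set.Ioc (tt (n - 1)) (tt n) := by
  classical
  have hex : ∃ n, t ≤ tt n := ⟨N, hT ▸ ht.2.le⟩
  have h1 : 1 ≤ Nat.find hex := by
    by_contra h
    have h2 := Nat.find_spec hex
    rw [show Nat.find hex = 0 by omega, h0] at h2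
    exact absurd ht.1 (not_lt.2 h2)
  exact ⟨Nat.find hex, h1, Nat.find_min' hex (hT ▸ ht.2.le),
    not_le.1 (Nat.find_min hex (by omega)), Nat.find_spec hex⟩

lemma supIoo_nonneg {g : ℝ → ℝ} (hg : ∀ t, 0 ≤ g t) (a b : ℝ) : 0 ≤ supIoo g a b :=
  Real.sSup_nonneg (by rintro _ ⟨t, -, rfl⟩; exact hg t)

lemma le_supIoo {g : ℝ → ℝ} {a b c d t : ℝ} (hg : BddAbove (g '' Set.Ioo c d)) (hc : c ≤ a)
    (hd : b ≤ d) (ht : t ∈ Set.Ioo a b) : g t ≤ supIoo g a b :=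
  le_csSup (hg.mono (Set.image_mono (Set.Ioo_subset_Ioo hc hd))) ⟨t, ht, rfl⟩

/-- Stability of the dG scheme: the distance from the discrete solution to the projection of the
exact solution, controlled by the projection errors. -/
lemma norm_pval_sub_dgProj_le {H : Type*} [NormedAddCommGroup H] [InnerProductSpace ℝ H]
    [CompleteSpace H] {φ : ℕ → H} {lam : ℕ → ℝ} (hφ : Orthonormal ℝ φ)
    (hφtotal : (Submodule.span ℝ (Set.range φ)).topologicalClosure = ⊤) (hlam : ∀ k, 0 < lam k)
    {q : ℕ} (hq : q = 0 ∨ q = 1) {N : ℕ} {T : ℝ} {tt : ℕ → ℝ} (h0 : tt 0 = 0) (hT : tt N = T)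
    (hmesh : ∀ n < N, tt n < tt (n + 1)) {f u1 u2 : ℝ → H}
    (hf : IntervalIntegrable f volume 0 T)
    (hu1 : ContinuousOn u1 (Set.Icc 0 T)) (hu2 : ContinuousOn u2 (Set.Icc 0 T))
    (hmem : ∀ t, MemHs φ lam 2 (u1 t))
    (hd1 : ∀ t ∈ Set.Ioo 0 T, HasDerivAt u1 (u2 t) t)
    (hd2 : ∀ t ∈ Set.Ioo 0 T, HasDerivAt u2 (f t - Aop φ lam (u1 t)) t)
    {c1 c2 : ℕ → ℕ → H}
    (hsch : ∀ d1 d2 : ℕ → ℕ → H, (∀ n j, MemHs φ lam 1 (d1 n j)) →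
        (∀ n j, MemHs φ lam 1 (d2 n j)) →
        Bform φ lam tt N q c1 c2 d1 d2 =
          (∑ n ∈ Finset.Icc 1 N, ∫ s in tt (n-1)..tt n, ⟪f s, pval q d2 n s⟫)
            + aForm φ lam (u1 0) (pval q d1 1 (tt 0)) + ⟪u2 0, pval q d2 1 (tt 0)⟫)
    {g : ℕ → ℝ}
    (hg : ∀ n, 1 ≤ n → n ≤ N → ∀ K, ∀ t ∈ Set.Icc (tt (n-1)) (tt n),
      ‖modeMap φ 1 K (dgProj q (tt (n-1)) (tt n) u2 t - u2 t)‖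
        + ‖modeMap φ (fun k => √(lam k)) K (dgProj q (tt (n-1)) (tt n) u1 t - u1 t)‖ ≤ g n)
    {n : ℕ} (hn : 1 ≤ n) (hnN : n ≤ N) {t : ℝ} (ht : t ∈ Set.Icc (tt (n-1)) (tt n)) :
    ‖pval q c1 n t - dgProj q (tt (n-1)) (tt n) u1 t‖
      ≤ 8 * ∑ m ∈ Finset.Icc 1 N, (tt m - tt (m-1)) * g m := by
  refine norm_le_of_norm_modeMap_le hφ hφtotal fun K => ?_
  set B : (ℕ → ℕ → H) → ℕ → H := fun c m => if q = 0 then 0 else c m 1 with hB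
  set θ : (ℕ → ℕ → H) → (ℝ → H) → ℕ → ℝ → H :=
    fun c u m s => pval q c m s - dgProj q (tt (m-1)) (tt m) u s with hθ
  have hθaff : ∀ c u m s, θ c u m s
      = (c m 0 - u (tt m) + tt m • dgSlope q (tt (m-1)) (tt m) u)
        + s • (B c m - dgSlope q (tt (m-1)) (tt m) u) := fun c u m s => by
    rw [← affine_sub_dgProj, hθ, hB]
    simp only [pval_eq_affine hq]
  set p : (ℕ → ℕ → H) → (ℝ → H) → ℕ → H :=
    fun c u m => if m = 0 then u 0 else pval q c m (tt m) with hp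
  have hpθ : ∀ c u m, 1 ≤ m → p c u m - u (tt m) = θ c u m (tt m) := fun c u m hm => by
    simp only [hp, hθ, dgProj_right, if_neg (by omega : m ≠ 0)]
  set x : ℕ → ℝ := fun m =>
    ‖energyMap φ lam K (p c1 u1 m - u1 (tt m)) (p c2 u2 m - u2 (tt m))‖ with hx
  set y : ℕ → ℝ := fun m =>
    ‖energyMap φ lam K (θ c1 u1 m (tt (m-1))) (θ c2 u2 m (tt (m-1)))‖ with hy
  set j : ℕ → ℝ := fun m =>
    ‖energyMap φ lam K (θ c1 u1 m (tt (m-1))) (θ c2 u2 m (tt (m-1)))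
      - energyMap φ lam K (p c1 u1 (m-1) - u1 (tt (m-1))) (p c2 u2 (m-1) - u2 (tt (m-1)))‖ with hj
  have hxθ : ∀ m, 1 ≤ m →
      x m = ‖energyMap φ lam K (θ c1 u1 m (tt m)) (θ c2 u2 m (tt m))‖ := fun m hm => by
    simp only [hx, hpθ _ _ m hm]
  have hen : ∀ m, 1 ≤ m → m ≤ N →
      x m ^ 2 + j m ^ 2 ≤ x (m-1) ^ 2 + 2 * ((tt m - tt (m-1)) * g m * max (x m) (y m)) := by
    intro m hm hmN
    obtain ⟨ha, hab, hb⟩ := mesh_mem h0 hT hmesh hm hmN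
    have hIcc : Set.Icc (tt (m-1)) (tt m) ⊆ Set.Icc 0 T := Set.Icc_subset_Icc ha hb
    have hIoo : Set.Ioo (tt (m-1)) (tt m) ⊆ Set.Ioo 0 T := Set.Ioo_subset_Ioo ha hb
    rw [hxθ m hm]
    refine interval_energy_le hφ hlam q K hab (A1 := c1 m 0) (A2 := c2 m 0) (B1 := B c1 m)
      (B2 := B c2 m) (p1 := p c1 u1 (m-1)) (p2 := p c2 u2 (m-1)) (hf.mono_set ?_)
      (hu1.mono hIcc) (hu2.mono hIcc) hmem (fun t ht => hd1 t (hIoo ht))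
      (fun t ht => hd2 t (hIoo ht)) (fun h => by simp [hB, h]) (fun k x0 x1 y0 y1 hxy => ?_)
      (hg m hm hmN K) (fun t => ?_) (fun t => ?_)
    · rw [Set.uIcc_of_le hab.le, Set.uIcc_of_le (ha.trans (hab.le.trans hb))]
      exact hIcc
    · have h := dG_scheme_mode hφ lam hq hsch k m hm hmN x0 x1 y0 y1 hxy
      have hprev : ∀ c u, (if m = 1 then u 0 else pval q c (m-1) (tt (m-1))) = p c u (m-1) :=
        fun c u => by simp only [hp, show m - 1 = 0 ↔ m = 1 by omega]
      rw [hprev c1 u1, hprev c2 u2] at h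
      simpa only [pval_eq_affine hq, pderiv_eq_slope hq, inner_add_left, inner_sub_left,
        real_inner_smul_left] using h
    · simp only [hθ, hB, pval_eq_affine hq]
    · simp only [hθ, hB, pval_eq_affine hq]
  have hgnonneg : ∀ m, 1 ≤ m → m ≤ N → 0 ≤ (tt m - tt (m-1)) * g m := fun m hm hmN => by
    obtain ⟨-, hab, -⟩ := mesh_mem h0 hT hmesh hm hmN
    exact mul_nonneg (by linarith)
      (le_trans (by positivity) (hg m hm hmN 0 _ (Set.left_mem_Icc.2 hab.le)))
  obtain ⟨h1, h2⟩ := energy_stability N x y j (fun m => (tt m - tt (m-1)) * g m)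
    (by simp [hx, hp, h0, energyMap]) (fun _ => norm_nonneg _) (fun _ => norm_nonneg _) hgnonneg
    (fun m _ _ => by
      simp only [hx, hy, hj]
      exact norm_le_norm_add_norm_sub' _ _) hen n hn hnN
  refine (norm_modeMap_le_energyMap φ lam K _ (θ c2 u2 n t)).trans ?_
  refine (norm_energyMap_affine_le φ lam K (hθaff c1 u1 n) (hθaff c2 u2 n)
    (mesh_mem h0 hT hmesh hn hnN).2.1 ht).trans (max_le ?_ h2)
  rwa [← hxθ n hn]

/-- **Theorem 4.2, second estimate (uniform-in-time L₂ error of dG(0)/dG(1) for the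
displacement).**
`‖e₁‖_{I_N} ≤ C (k^{q+1}‖u₁^{(q+1)}‖_{I_N} + Σₙ kₙ^{q+2}‖u₂^{(q+1)}‖_{Iₙ}
  + Σₙ kₙ^{q+2}‖u₁^{(q+1)}‖_{1,Iₙ})`. -/
theorem dG_uniform_error_L2
    {H : Type*} [NormedAddCommGroup H] [InnerProductSpace ℝ H] [CompleteSpace H]
    (φ : ℕ → H) (lam : ℕ → ℝ)
    (hφ : Orthonormal ℝ φ)
    (hφtotal : (Submodule.span ℝ (Set.range φ)).topologicalClosure = ⊤)
    (hlam_pos : ∀ k, 0 < lam k) (hlam_mono : Monotone lam)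
    (hlam_top : Filter.Tendsto lam Filter.atTop Filter.atTop)
    (q : ℕ) (hq : q = 0 ∨ q = 1) :
    ∃ C : ℝ, 0 < C ∧
      ∀ (T : ℝ), 0 < T → ∀ (N : ℕ), ∀ hN : 1 ≤ N,
      ∀ tt : ℕ → ℝ, tt 0 = 0 → tt N = T → (∀ n < N, tt n < tt (n + 1)) →
      -- data
      ∀ f : ℝ → H, IntervalIntegrable f volume 0 T →
      ∀ u0 v0 : H, MemHs φ lam 1 u0 →
      -- exact solution (u₁,u₂)
      ∀ u1 u2 : ℝ → H,
      u1 0 = u0 → u2 0 = v0 →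
      ContinuousOn u1 (Set.Icc 0 T) → ContinuousOn u2 (Set.Icc 0 T) →
      (∀ t, MemHs φ lam 2 (u1 t)) → (∀ t, MemHs φ lam 1 (u2 t)) →
      (∀ t ∈ Set.Ioo 0 T, HasDerivAt u1 (u2 t) t) →
      (∀ t ∈ Set.Ioo 0 T, HasDerivAt u2 (f t - Aop φ lam (u1 t)) t) →
      -- temporal regularity of the exact solution
      (∀ m < q + 1, ∀ t ∈ Set.Ioo 0 T,
        HasDerivAt (iteratedDeriv m u1) (iteratedDeriv (m+1) u1 t) t) →
      (∀ m < q + 1, ∀ t ∈ Set.Ioo 0 T,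
        HasDerivAt (iteratedDeriv m u2) (iteratedDeriv (m+1) u2 t) t) →
      (∀ t, MemHs φ lam 1 (iteratedDeriv (q+1) u1 t)) →
      -- finiteness of the right-hand side
      BddAbove ((fun t => ‖iteratedDeriv (q+1) u1 t‖) '' Set.Ioo 0 T) →
      BddAbove ((fun t => ‖iteratedDeriv (q+1) u2 t‖) '' Set.Ioo 0 T) →
      BddAbove ((fun t => hsNorm φ lam 1 (iteratedDeriv (q+1) u1 t)) '' Set.Ioo 0 T) →
      -- the dG(q) approximation U = (U₁,U₂) ∈ 𝒱_q (coefficient families c1, c2)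
      ∀ c1 c2 : ℕ → ℕ → H,
      (∀ n j, MemHs φ lam 1 (c1 n j)) → (∀ n j, MemHs φ lam 1 (c2 n j)) →
      (∀ d1 d2 : ℕ → ℕ → H, (∀ n j, MemHs φ lam 1 (d1 n j)) →
        (∀ n j, MemHs φ lam 1 (d2 n j)) →
        Bform φ lam tt N q c1 c2 d1 d2 =
          (∑ n ∈ Finset.Icc 1 N, ∫ s in tt (n-1)..tt n, ⟪f s, pval q d2 n s⟫)
            + aForm φ lam u0 (pval q d1 1 (tt 0)) + ⟪v0, pval q d2 1 (tt 0)⟫) →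
      -- U₁, U₂ as functions of time (left-continuous piecewise polynomials)
      ∀ U1f U2f : ℝ → H,
      (∀ n ∈ Finset.Icc 1 N, ∀ t ∈ Set.Ioc (tt (n-1)) (tt n), U1f t = pval q c1 n t) →
      (∀ n ∈ Finset.Icc 1 N, ∀ t ∈ Set.Ioc (tt (n-1)) (tt n), U2f t = pval q c2 n t) →
      (BddAbove ((fun t => ‖U1f t - u1 t‖) '' Set.Ioo 0 T) ∧
       supIoo (fun t => ‖U1f t - u1 t‖) 0 T
        ≤ C * (((Finset.Icc 1 N).sup' (Finset.nonempty_Icc.mpr hN)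
                  (fun n => tt n - tt (n-1))) ^ (q+1) *
                supIoo (fun t => ‖iteratedDeriv (q+1) u1 t‖) 0 T
            + (∑ n ∈ Finset.Icc 1 N, (tt n - tt (n-1)) ^ (q+2) *
                supIoo (fun t => ‖iteratedDeriv (q+1) u2 t‖)
                  (tt (n-1)) (tt n))
            + (∑ n ∈ Finset.Icc 1 N, (tt n - tt (n-1)) ^ (q+2) *
                supIoo (fun t => hsNorm φ lam 1 (iteratedDeriv (q+1) u1 t))
                  (tt (n-1)) (tt n)))) := by
  refine ⟨48, by norm_num, ?_⟩
  intro T hTpos N hN tt h0 hT hmesh f hf u0 v0 _ u1 u2 hu10 hu20 hu1 hu2 hmem _ hd1 hd2 hr1 hr2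
    hm1 hb1 hb2 hb3 c1 c2 _ _ hsch U1f U2f hU1 _
  subst hu10 hu20
  set M := supIoo (fun t => ‖iteratedDeriv (q+1) u1 t‖) 0 T with hM
  set M2 : ℕ → ℝ := fun n => supIoo (fun t => ‖iteratedDeriv (q+1) u2 t‖) (tt (n-1)) (tt n)
    with hM2
  set M1 : ℕ → ℝ := fun n =>
    supIoo (fun t => hsNorm φ lam 1 (iteratedDeriv (q+1) u1 t)) (tt (n-1)) (tt n) with hM1
  set κ := (Finset.Icc 1 N).sup' (Finset.nonempty_Icc.mpr hN) (fun n => tt n - tt (n-1)) with hκ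
  set g : ℕ → ℝ := fun n => 6 * ((tt n - tt (n-1)) ^ (q+1) * M2 n)
    + 6 * ((tt n - tt (n-1)) ^ (q+1) * M1 n) with hgdef
  have hM0 : 0 ≤ M := supIoo_nonneg (fun _ => norm_nonneg _) _ _
  have hg : ∀ n, 1 ≤ n → n ≤ N → ∀ K, ∀ t ∈ Set.Icc (tt (n-1)) (tt n),
      ‖modeMap φ 1 K (dgProj q (tt (n-1)) (tt n) u2 t - u2 t)‖
        + ‖modeMap φ (fun k => √(lam k)) K (dgProj q (tt (n-1)) (tt n) u1 t - u1 t)‖ ≤ g n := by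
    intro n hn hnN K t ht
    obtain ⟨ha, hab, hb⟩ := mesh_mem h0 hT hmesh hn hnN
    have hIoo : Set.Ioo (tt (n-1)) (tt n) ⊆ Set.Ioo 0 T := Set.Ioo_subset_Ioo ha hb
    refine add_le_add ?_ ?_
    · exact norm_map_dgProj_sub_le _ hq hab (hu2.mono (Set.Icc_subset_Icc ha hb))
        (fun m hm s hs => hr2 m hm s (hIoo hs))
        (fun s hs => (norm_modeMap_one_le hφ K _).trans (le_supIoo hb2 ha hb hs)) ht
    · exact norm_map_dgProj_sub_le _ hq hab (hu1.mono (Set.Icc_subset_Icc ha hb))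
        (fun m hm s hs => hr1 m hm s (hIoo hs))
        (fun s hs => (norm_modeMap_sqrt_le φ hlam_pos K (hm1 s)).trans
          (le_supIoo (g := fun t => hsNorm φ lam 1 (iteratedDeriv (q+1) u1 t))
            hb3 ha hb hs)) ht
  have hsum : ∑ n ∈ Finset.Icc 1 N, (tt n - tt (n-1)) * g n
      = 6 * (∑ n ∈ Finset.Icc 1 N, (tt n - tt (n-1)) ^ (q+2) * M2 n
        + ∑ n ∈ Finset.Icc 1 N, (tt n - tt (n-1)) ^ (q+2) * M1 n) := by
    rw [← Finset.sum_add_distrib, Finset.mul_sum]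
    refine Finset.sum_congr rfl fun n _ => ?_
    simp only [hgdef]
    ring
  have hκ0 : 0 ≤ κ := by
    have h := Finset.le_sup' (fun n => tt n - tt (n-1)) (Finset.mem_Icc.2 ⟨le_rfl, hN⟩)
    have h' := (mesh_mem h0 hT hmesh le_rfl hN).2.1
    exact le_trans (by simpa using h'.le) h
  have hbound : ∀ t ∈ Set.Ioo 0 T, ‖U1f t - u1 t‖ ≤ 48 * (κ ^ (q+1) * M
      + ∑ n ∈ Finset.Icc 1 N, (tt n - tt (n-1)) ^ (q+2) * M2 n
      + ∑ n ∈ Finset.Icc 1 N, (tt n - tt (n-1)) ^ (q+2) * M1 n) := by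
    intro t ht
    obtain ⟨n, hn, hnN, htn⟩ := exists_mem_mesh_Ioc h0 hT ht
    have htn' := Set.Ioc_subset_Icc_self htn
    obtain ⟨ha, hab, hb⟩ := mesh_mem h0 hT hmesh hn hnN
    have hIoo : Set.Ioo (tt (n-1)) (tt n) ⊆ Set.Ioo 0 T := Set.Ioo_subset_Ioo ha hb
    have hstab := norm_pval_sub_dgProj_le hφ hφtotal hlam_pos hq h0 hT hmesh hf hu1 hu2 hmem
      hd1 hd2 hsch hg hn hnN htn'
    have hproj := norm_map_dgProj_sub_le (ContinuousLinearMap.id ℝ H) hq hab (M := M)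
      (hu1.mono (Set.Icc_subset_Icc ha hb)) (fun m hm s hs => hr1 m hm s (hIoo hs))
      (fun s hs => le_supIoo hb1 le_rfl le_rfl (hIoo hs)) htn'
    have hstep : (tt n - tt (n-1)) ^ (q+1) * M ≤ κ ^ (q+1) * M :=
      mul_le_mul_of_nonneg_right (pow_le_pow_left₀ (by linarith)
        (Finset.le_sup' (fun n => tt n - tt (n-1)) (Finset.mem_Icc.2 ⟨hn, hnN⟩)) _) hM0
    have hκM : 0 ≤ κ ^ (q+1) * M := by positivity
    rw [ContinuousLinearMap.id_apply] at hproj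
    have htri := norm_add_le (pval q c1 n t - dgProj q (tt (n-1)) (tt n) u1 t)
      (dgProj q (tt (n-1)) (tt n) u1 t - u1 t)
    rw [sub_add_sub_cancel] at htri
    rw [hsum] at hstab
    rw [hU1 n (Finset.mem_Icc.2 ⟨hn, hnN⟩) t htn]
    linarith
  exact ⟨⟨_, by rintro _ ⟨t, ht, rfl⟩; exact hbound t ht⟩,
    csSup_le ((Set.nonempty_Ioo.2 hTpos).image _) (by rintro _ ⟨t, ht, rfl⟩; exact hbound t ht)⟩
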